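/- Let α > −1. For every n ≥ 0, the (n+1)×(n+1) matrix with (i,j) entry (α+1)_{i+j} (the shifted factorial, i.e. Γ(α+1+i+j)/Γ(α+1)), for 0 ≤ i,j ≤ n, has determinant equal to ∏_{k=0}^{n} k! · (α+1)_k. Equivalently, det(Γ(α+i+j+1))_{0≤i,j≤n} = ∏_{k=0}^{n} k! · Γ(α+k+1). -/

import Mathlib

/-- The shifted factorial (Pochhammer symbol) `(x)_m = x (x+1) ⋯ (x+m-1)`. -/
noncomputable def poch (x : ℝ) (m : ℕ) : ℝ := Polynomial.eval x (ascPochhammer ℝ m)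

lemma poch_add (x : ℝ) (i j : ℕ) : poch x (i + j) = poch x i * poch (x + i) j := by
  unfold poch
  rw [← ascPochhammer_mul]
  simp

lemma Gamma_eq_poch (x : ℝ) (hx : 0 < x) (m : ℕ) :
    Real.Gamma (x + m) = Real.Gamma x * poch x m := by
  induction m with
  | zero => simp [poch]
  | succ k ih =>
    have h : x + (k : ℝ) ≠ 0 := by positivity
    have h2 : poch x (k + 1) = poch x k * (x + k) := by
      unfold poch
      exact ascPochhammer_succ_eval k x
    rw [h2, Nat.cast_succ, ← add_assoc, Real.Gamma_add_one h, ih]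
    ring

lemma det_poch (x : ℝ) (n : ℕ) :
    Matrix.det (Matrix.of fun i j : Fin (n + 1) => poch x ((i : ℕ) + (j : ℕ))) =
      ∏ k ∈ Finset.range (n + 1), (Nat.factorial k : ℝ) * poch x k := by
  have h1 := Matrix.det_mul_column (fun i : Fin (n + 1) => poch x i)
    (Matrix.of fun i j : Fin (n + 1) => poch (x + (i : ℕ)) (j : ℕ))
  have h2 := Matrix.det_eval_matrixOfPolynomials_eq_det_vandermonde
    (fun i : Fin (n + 1) => ((i : ℕ) : ℝ) + x) (fun j => ascPochhammer ℝ (j : ℕ))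
    (fun j => ascPochhammer_natDegree ℝ (j : ℕ)) (fun j => monic_ascPochhammer ℝ (j : ℕ))
  rw [Matrix.det_vandermonde_add, Matrix.det_vandermonde_id_eq_superFactorial] at h2
  have h3 : (Matrix.of fun i j : Fin (n + 1) => poch (x + (i : ℕ)) (j : ℕ)).det =
      (n.superFactorial : ℝ) := by
    rw [h2]
    simp only [poch, add_comm]
  simp only [poch_add]
  rw [h3] at h1
  refine h1.trans ?_
  rw [Finset.prod_mul_distrib, ← Nat.prod_range_succ_factorial, Nat.cast_prod, mul_comm,
    Finset.prod_range (fun k => poch x k)]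

/-- For `α > -1` and every `n ≥ 0`, the `(n+1) × (n+1)` matrix with `(i,j)` entry
`(α+1)_{i+j}` has determinant `∏_{k=0}^n k! (α+1)_k`; equivalently,
`det (Γ(α+i+j+1))_{0 ≤ i,j ≤ n} = ∏_{k=0}^n k! Γ(α+k+1)`. -/
theorem laguerre_moment_matrix_det (α : ℝ) (hα : -1 < α) (n : ℕ) :
    Matrix.det (Matrix.of fun i j : Fin (n + 1) => poch (α + 1) ((i : ℕ) + (j : ℕ))) =
      ∏ k ∈ Finset.range (n + 1), (Nat.factorial k : ℝ) * poch (α + 1) k ∧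
    Matrix.det (Matrix.of fun i j : Fin (n + 1) =>
        Real.Gamma (α + (i : ℕ) + (j : ℕ) + 1)) =
      ∏ k ∈ Finset.range (n + 1), (Nat.factorial k : ℝ) * Real.Gamma (α + k + 1) := by
  refine ⟨det_poch _ n, ?_⟩
  have h : ∀ m : ℕ, Real.Gamma (α + m + 1) = Real.Gamma (α + 1) * poch (α + 1) m := by
    intro m
    rw [← Gamma_eq_poch _ (by linarith)]
    congr 1
    ring
  have e : (Matrix.of fun i j : Fin (n + 1) => Real.Gamma (α + (i : ℕ) + (j : ℕ) + 1)) =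
      Real.Gamma (α + 1) •
        Matrix.of fun i j : Fin (n + 1) => poch (α + 1) ((i : ℕ) + (j : ℕ)) := by
    ext i j
    have := h ((i : ℕ) + (j : ℕ))
    push_cast at this
    rw [← add_assoc] at this
    simpa using this
  rw [e, Matrix.det_smul, det_poch]
  simp only [h, Fintype.card_fin]
  simp only [Finset.prod_mul_distrib, Finset.prod_const, Finset.card_range]
  ring
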